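/- Let (Q_k) be a countable family of balls in ℝ^d such that the dilated balls satisfy the bounded overlap condition Σ_k 1_{10Q_k} ≤ C₀. Then for every 1 ≤ q₁ < ∞, the Marcinkiewicz function M_{(Q_k)}(x) := Σ_k (1 + |x − c_k|/|Q_k|^{1/d})^{−(d+1)} (c_k the center of Q_k) satisfies the weak type bound ‖M_{(Q_k)}‖_{L^{q₁,∞}} ≲ |⋃_k Q_k|^{1/q₁}, with implicit constant depending only on d, q₁ and C₀. -/

import Mathlib

open MeasureTheory
open scoped ENNReal NNReal

/-- Weak Lebesgue quasinorm `‖f‖_{L^{p,∞}} = sup_{α>0} α |{|f| > α}|^{1/p}`. -/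
noncomputable def wnorm {E : Type*} [NormedAddCommGroup E] {d : ℕ}
    (f : EuclideanSpace ℝ (Fin d) → E) (p : ℝ≥0∞) : ℝ≥0∞ :=
  ⨆ t : ℝ≥0, (t : ℝ≥0∞) * (volume {x | (t : ℝ) < ‖f x‖}) ^ p⁻¹.toReal

open Metric Set Module

section MaximalDensity

variable {X : Type*} [NormedAddCommGroup X] [NormedSpace ℝ X] [FiniteDimensional ℝ X]
  [MeasurableSpace X] [BorelSpace X]

/-- The uncentered Hardy–Littlewood maximal function of the indicator of `E`. -/
noncomputable def maximalDensity (μ : Measure X) (E : Set X) (x : X) : ℝ≥0∞ :=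
  ⨆ z : X, ⨆ r : ℝ,
    (ball z r).indicator (fun _ => μ (closedBall z r ∩ E) / μ (closedBall z r)) x

variable (μ : Measure X) [μ.IsAddHaarMeasure] (E : Set X)

omit [NormedSpace ℝ X] [FiniteDimensional ℝ X] [BorelSpace X] [μ.IsAddHaarMeasure] in
lemma maximalDensity_le_one (x : X) : maximalDensity μ E x ≤ 1 := by
  refine iSup₂_le fun z r => indicator_le_self' (fun _ _ => zero_le) x |>.trans ?_
  exact ENNReal.div_le_of_le_mul (by rw [one_mul]; exact measure_mono inter_subset_left)

omit [NormedSpace ℝ X] [FiniteDimensional ℝ X] [μ.IsAddHaarMeasure] in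
lemma measurable_maximalDensity : Measurable (maximalDensity μ E) := by
  refine LowerSemicontinuous.measurable ?_
  exact lowerSemicontinuous_iSup fun z => lowerSemicontinuous_iSup fun r =>
    isOpen_ball.lowerSemicontinuous_indicator zero_le

omit [BorelSpace X] in
lemma measure_ball_inter_le_maximalDensity {x z : X} {r : ℝ} (hx : x ∈ ball z r) :
    μ (ball z r ∩ E) ≤ maximalDensity μ E x * μ (closedBall z r) := by
  have hr : 0 < r := pos_of_mem_ball hx
  have h : μ (closedBall z r ∩ E) / μ (closedBall z r) ≤ maximalDensity μ E x := by
    refine le_iSup₂_of_le z r ?_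
    rw [indicator_of_mem hx]
  rw [ENNReal.div_le_iff (measure_closedBall_pos μ z hr).ne' measure_closedBall_lt_top.ne] at h
  exact (measure_mono (inter_subset_inter_left _ ball_subset_closedBall)).trans h

/-- The weak type `(1, 1)` bound for the maximal function of an indicator. -/
lemma mul_measure_lt_maximalDensity_le [Nontrivial X] {s : ℝ≥0∞} (hs : s ≠ 0) (hs' : s ≠ ⊤) :
    s * μ {x | s < maximalDensity μ E x} ≤ 5 ^ finrank ℝ X * μ E := by
  rcases eq_or_ne (μ E) ⊤ with hE | hE
  · rw [hE, ENNReal.mul_top (by simp)]; exact le_top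
  let t : Set (X × ℝ) := {p | 0 < p.2 ∧ s * μ (closedBall p.1 p.2) < μ (closedBall p.1 p.2 ∩ E)}
  have hb0 : μ (ball (0 : X) 1) ≠ 0 := (measure_ball_pos μ 0 one_pos).ne'
  have hb1 : μ (ball (0 : X) 1) ≠ ⊤ := measure_ball_lt_top.ne
  have hbdd : ∀ p ∈ t, p.2 ≤ max 1 (μ E / (s * μ (ball (0 : X) 1))).toReal := by
    rintro ⟨z, r⟩ ⟨hr, hp⟩
    simp only at hr hp
    rcases le_total r 1 with h1 | h1
    · exact h1.trans (le_max_left _ _)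
    refine le_trans ?_ (le_max_right _ _)
    have h2 : ENNReal.ofReal (r ^ finrank ℝ X) ≤ μ E / (s * μ (ball (0 : X) 1)) := by
      rw [ENNReal.le_div_iff_mul_le (Or.inl (mul_ne_zero hs hb0))
        (Or.inl (ENNReal.mul_ne_top hs' hb1))]
      rw [Measure.addHaar_closedBall μ z hr.le] at hp
      calc _ = s * (ENNReal.ofReal (r ^ finrank ℝ X) * μ (ball 0 1)) := by ring
        _ ≤ μ E := hp.le.trans (measure_mono inter_subset_right)
    have h3 := (ENNReal.ofReal_le_iff_le_toReal
      (ENNReal.div_ne_top hE (mul_ne_zero hs hb0))).1 h2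
    exact (le_self_pow₀ h1 finrank_pos.ne').trans h3
  obtain ⟨u, hut, hdisj, hcov⟩ :=
    Vitali.exists_disjoint_subfamily_covering_enlargement_closedBall t Prod.fst Prod.snd _ hbdd 5
      (by norm_num)
  have hcount : u.Countable := hdisj.countable_of_nonempty_interior fun p hp =>
    (nonempty_ball.2 (hut hp).1).mono ball_subset_interior_closedBall
  have hsub : {x | s < maximalDensity μ E x} ⊆ ⋃ p ∈ u, closedBall p.1 (5 * p.2) := by
    intro x hx
    simp only [maximalDensity, mem_ofPred_eq, lt_iSup_iff] at hx
    obtain ⟨z, r, hx⟩ := hx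
    by_cases hxz : x ∈ ball z r
    swap
    · simp [indicator_of_notMem hxz] at hx
    rw [indicator_of_mem hxz] at hx
    have hr : 0 < r := pos_of_mem_ball hxz
    have hzt : (z, r) ∈ t := ⟨hr, by
      rwa [ENNReal.lt_div_iff_mul_lt (Or.inl (measure_closedBall_pos μ z hr).ne')
        (Or.inl measure_closedBall_lt_top.ne)] at hx⟩
    obtain ⟨p, hp, hzp⟩ := hcov _ hzt
    exact mem_biUnion hp (hzp (ball_subset_closedBall hxz))
  calc s * μ {x | s < maximalDensity μ E x}
      ≤ s * ∑' p : u, μ (closedBall p.1.1 (5 * p.1.2)) := by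
        gcongr
        exact (measure_mono hsub).trans (measure_biUnion_le μ hcount _)
    _ = ∑' p : u, 5 ^ finrank ℝ X * (s * μ (closedBall p.1.1 p.1.2)) := by
        rw [← ENNReal.tsum_mul_left]
        refine tsum_congr fun p => ?_
        have hp := (hut p.2).1.le
        rw [Measure.addHaar_closedBall_mul μ _ (by norm_num) hp, ENNReal.ofReal_pow (by norm_num),
          ← Measure.addHaar_closedBall_center μ p.1.1]
        simp only [ENNReal.ofReal_ofNat]
        ring
    _ ≤ ∑' p : u, 5 ^ finrank ℝ X * μ.restrict E (closedBall p.1.1 p.1.2) := by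
        refine ENNReal.tsum_le_tsum fun p => ?_
        gcongr
        rw [Measure.restrict_apply measurableSet_closedBall]
        exact (hut p.2).2.le
    _ = 5 ^ finrank ℝ X * μ.restrict E (⋃ p ∈ u, closedBall p.1 p.2) := by
        rw [ENNReal.tsum_mul_left,
          measure_biUnion hcount hdisj fun _ _ => measurableSet_closedBall]
    _ ≤ 5 ^ finrank ℝ X * μ E := mul_le_mul_right
        ((measure_mono (subset_univ _)).trans_eq (Measure.restrict_apply_univ _)) _

/-- A Kolmogorov-type bound for the maximal function of an indicator over a set `U`. -/
lemma setLIntegral_maximalDensity_le [Nontrivial X] (U : Set X) {θ : ℝ} (hθ : 0 < θ)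
    (hθ' : θ ≤ 1) :
    ∫⁻ x in U, maximalDensity μ E x ∂μ ≤
      (∫⁻ s in Ioo (0 : ℝ) 1, ENNReal.ofReal (s ^ (θ - 1))) *
        (μ U ^ θ * (5 ^ finrank ℝ X * μ E) ^ (1 - θ)) := by
  have hne : ∀ x, maximalDensity μ E x ≠ ⊤ := fun x =>
    ((maximalDensity_le_one μ E x).trans_lt ENNReal.one_lt_top).ne
  have hmeas := measurable_maximalDensity μ E
  have hlc := lintegral_eq_lintegral_meas_lt (μ.restrict U)
    (f := fun x => (maximalDensity μ E x).toReal)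
    (.of_forall fun _ => ENNReal.toReal_nonneg) hmeas.ennreal_toReal.aemeasurable
  simp only [ENNReal.ofReal_toReal (hne _)] at hlc
  rw [hlc, ← lintegral_mul_const _ (by fun_prop), ← lintegral_indicator measurableSet_Ioi,
    ← lintegral_indicator measurableSet_Ioo]
  refine lintegral_mono fun s => ?_
  by_cases hs0 : 0 < s
  swap
  · simp [hs0]
  rw [indicator_of_mem (mem_Ioi.2 hs0)]
  by_cases hs1 : s < 1
  swap
  · have : {x | s < (maximalDensity μ E x).toReal} = ∅ := by
      refine eq_empty_of_forall_notMem fun x hx => ?_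
      have h1 := ENNReal.toReal_mono ENNReal.one_ne_top (maximalDensity_le_one μ E x)
      simp only [mem_ofPred_eq, ENNReal.toReal_one] at hx h1
      linarith
    simp [this]
  rw [indicator_of_mem (mem_Ioo.2 ⟨hs0, hs1⟩)]
  set m := μ.restrict U {x | s < (maximalDensity μ E x).toReal}
  have hmU : m ≤ μ U := (measure_mono (subset_univ _)).trans_eq (Measure.restrict_apply_univ _)
  have hs0' : ENNReal.ofReal s ≠ 0 := (ENNReal.ofReal_pos.2 hs0).ne'
  have hmE : m ≤ 5 ^ finrank ℝ X * μ E * (ENNReal.ofReal s)⁻¹ := by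
    rw [← div_eq_mul_inv, ENNReal.le_div_iff_mul_le (Or.inl hs0') (Or.inl ENNReal.ofReal_ne_top),
      mul_comm]
    refine le_trans ?_ (mul_measure_lt_maximalDensity_le μ E hs0' ENNReal.ofReal_ne_top)
    gcongr
    refine (Measure.restrict_apply_le _ _).trans (measure_mono fun x hx => ?_)
    exact (ENNReal.ofReal_lt_iff_lt_toReal hs0.le (hne x)).2 hx
  calc m = m ^ θ * m ^ (1 - θ) := by
        rw [← ENNReal.rpow_add_of_nonneg _ _ hθ.le (by linarith)]; simp
    _ ≤ μ U ^ θ * (5 ^ finrank ℝ X * μ E * (ENNReal.ofReal s)⁻¹) ^ (1 - θ) := by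
        gcongr
    _ = _ := by
        rw [ENNReal.mul_rpow_of_nonneg _ _ (by linarith), ENNReal.inv_rpow, ← ENNReal.rpow_neg,
          neg_sub, ENNReal.ofReal_rpow_of_pos hs0]
        ring

omit [NormedSpace ℝ X] [FiniteDimensional ℝ X] [MeasurableSpace X] [BorelSpace X] in
/-- Dyadic domination of a polynomially decaying bump by indicators of concentric balls. -/
lemma ofReal_bump_le_tsum_indicator_ball (n : ℕ) (c : X) {r : ℝ} (hr : 0 < r) (y : X) :
    ENNReal.ofReal ((1 + ‖y - c‖ / r) ^ (-(n + 1) : ℝ)) ≤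
      ∑' j : ℕ, (ball c (2 ^ j * r)).indicator
        (fun _ => 2 ^ (n + 1) * ENNReal.ofReal ((2 ^ j) ^ (n + 1))⁻¹) y := by
  set v := ‖y - c‖ / r with hv
  have hv0 : 0 ≤ v := by positivity
  have hrw : (1 + v) ^ (-(n + 1) : ℝ) = ((1 + v) ^ (n + 1))⁻¹ := by
    rw [Real.rpow_neg (by positivity)]
    exact_mod_cast rfl
  have key : ∃ j : ℕ, v < 2 ^ j ∧ (2 : ℝ) ^ j ≤ 2 * (1 + v) := by
    rcases lt_or_ge v 1 with h | h
    · exact ⟨0, by simpa using h, by norm_num; linarith⟩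
    · obtain ⟨j, h1, h2⟩ := exists_nat_pow_near h (one_lt_two (α := ℝ))
      exact ⟨j + 1, h2, by rw [pow_succ]; linarith⟩
  obtain ⟨j, h1, h2⟩ := key
  refine le_trans ?_ (ENNReal.le_tsum j)
  rw [indicator_of_mem, hrw]
  · have : ((1 + v) ^ (n + 1))⁻¹ ≤ 2 ^ (n + 1) * ((2 ^ j) ^ (n + 1))⁻¹ := by
      rw [← div_eq_mul_inv, le_div_iff₀ (by positivity), inv_mul_le_iff₀ (by positivity),
        ← mul_pow, mul_comm (1 + v)]
      gcongr
    refine (ENNReal.ofReal_le_ofReal this).trans ?_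
    rw [ENNReal.ofReal_mul (by positivity), ENNReal.ofReal_pow (by norm_num)]
    simp
  · rw [mem_ball, dist_eq_norm]
    rwa [hv, div_lt_iff₀ hr] at h1

lemma setLIntegral_bump_le {E : Set X} {c x : X} {r : ℝ} (hx : x ∈ ball c r) :
    ∫⁻ y in E, ENNReal.ofReal ((1 + ‖y - c‖ / r) ^ (-(finrank ℝ X + 1) : ℝ)) ∂μ ≤
      2 ^ (finrank ℝ X + 2) * μ (ball c r) * maximalDensity μ E x := by
  have hr : 0 < r := pos_of_mem_ball hx
  set n := finrank ℝ X with hn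
  calc _ ≤ ∫⁻ y in E, ∑' j : ℕ, (ball c (2 ^ j * r)).indicator
        (fun _ => 2 ^ (n + 1) * ENNReal.ofReal ((2 ^ j) ^ (n + 1))⁻¹) y ∂μ :=
        lintegral_mono fun y => ofReal_bump_le_tsum_indicator_ball n c hr y
    _ = ∑' j : ℕ, 2 ^ (n + 1) * ENNReal.ofReal ((2 ^ j) ^ (n + 1))⁻¹ *
          μ (ball c (2 ^ j * r) ∩ E) := by
        rw [lintegral_tsum fun j => (measurable_const.indicator measurableSet_ball).aemeasurable]
        refine tsum_congr fun j => ?_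
        rw [lintegral_indicator_const measurableSet_ball,
          Measure.restrict_apply measurableSet_ball]
    _ ≤ ∑' j : ℕ, 2 ^ (n + 1) * μ (ball c r) * maximalDensity μ E x * 2⁻¹ ^ j := by
        refine ENNReal.tsum_le_tsum fun j => ?_
        have h1 : x ∈ ball c (2 ^ j * r) :=
          ball_subset_ball (le_mul_of_one_le_left hr.le (one_le_pow₀ one_le_two)) hx
        have h2 : ENNReal.ofReal ((2 ^ j) ^ (n + 1))⁻¹ * μ (closedBall c (2 ^ j * r)) =
            2⁻¹ ^ j * μ (ball c r) := by
          rw [Measure.addHaar_closedBall μ _ (by positivity), Measure.addHaar_ball_of_pos μ _ hr,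
            ← mul_assoc, ← ENNReal.ofReal_mul (by positivity), ← hn]
          have : (((2 : ℝ) ^ j) ^ (n + 1))⁻¹ * (2 ^ j * r) ^ n = 2⁻¹ ^ j * r ^ n := by
            rw [mul_pow, pow_succ, inv_pow]
            field_simp
          rw [this, ENNReal.ofReal_mul (by positivity), ENNReal.ofReal_pow (by positivity),
            ENNReal.ofReal_inv_of_pos two_pos]
          simp only [ENNReal.ofReal_ofNat]
          ring
        calc _ ≤ 2 ^ (n + 1) * ENNReal.ofReal ((2 ^ j) ^ (n + 1))⁻¹ *
              (maximalDensity μ E x * μ (closedBall c (2 ^ j * r))) := by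
              gcongr
              exact measure_ball_inter_le_maximalDensity μ E h1
          _ = 2 ^ (n + 1) * maximalDensity μ E x *
              (ENNReal.ofReal ((2 ^ j) ^ (n + 1))⁻¹ * μ (closedBall c (2 ^ j * r))) := by ring
          _ = _ := by rw [h2]; ring
    _ = _ := by
        rw [ENNReal.tsum_mul_left, ENNReal.tsum_geometric, ENNReal.one_sub_inv_two, inv_inv]
        ring

lemma setLIntegral_bump_le_setLIntegral_maximalDensity (E : Set X) (c : X) {r : ℝ} (hr : 0 < r) :
    ∫⁻ y in E, ENNReal.ofReal ((1 + ‖y - c‖ / r) ^ (-(finrank ℝ X + 1) : ℝ)) ∂μ ≤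
      2 ^ (finrank ℝ X + 2) * ∫⁻ x in ball c r, maximalDensity μ E x ∂μ := by
  set I := ∫⁻ y in E, ENNReal.ofReal ((1 + ‖y - c‖ / r) ^ (-(finrank ℝ X + 1) : ℝ)) ∂μ
  have hb0 : μ (ball c r) ≠ 0 := (measure_ball_pos μ c hr).ne'
  have hb1 : μ (ball c r) ≠ ⊤ := measure_ball_lt_top.ne
  have h : μ (ball c r) * I ≤
      μ (ball c r) * (2 ^ (finrank ℝ X + 2) * ∫⁻ x in ball c r, maximalDensity μ E x ∂μ) := by
    rw [← mul_assoc, mul_comm _ I, ← setLIntegral_const, mul_comm (μ _),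
      ← lintegral_const_mul _ (measurable_maximalDensity μ E)]
    exact setLIntegral_mono' measurableSet_ball fun x hx => setLIntegral_bump_le μ hx
  exact (ENNReal.mul_le_mul_iff_right hb0 hb1).1 h

lemma setLIntegral_tsum_bump_le {E : Set X} {C₀ : ℝ≥0∞} {c : ℕ → X} {rad : ℕ → ℝ}
    (hrad : ∀ k, 0 < rad k)
    (hC : ∀ x, ∑' k, (ball (c k) (rad k)).indicator (fun _ => (1 : ℝ≥0∞)) x ≤ C₀) :
    ∫⁻ y in E, ∑' k, ENNReal.ofReal
        ((1 + ‖y - c k‖ / rad k) ^ (-(finrank ℝ X + 1) : ℝ)) ∂μ ≤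
      2 ^ (finrank ℝ X + 2) * C₀ *
        ∫⁻ x in ⋃ k, ball (c k) (rad k), maximalDensity μ E x ∂μ := by
  have hmeas := measurable_maximalDensity μ E
  have hU : MeasurableSet (⋃ k, ball (c k) (rad k)) := .iUnion fun _ => measurableSet_ball
  rw [lintegral_tsum fun k => by fun_prop]
  calc _ ≤ ∑' k, 2 ^ (finrank ℝ X + 2) * ∫⁻ x in ball (c k) (rad k), maximalDensity μ E x ∂μ :=
        ENNReal.tsum_le_tsum fun k =>
          setLIntegral_bump_le_setLIntegral_maximalDensity μ E (c k) (hrad k)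
    _ = 2 ^ (finrank ℝ X + 2) *
          ∫⁻ x, ∑' k, (ball (c k) (rad k)).indicator (maximalDensity μ E) x ∂μ := by
        rw [ENNReal.tsum_mul_left,
          lintegral_tsum fun k => (hmeas.indicator measurableSet_ball).aemeasurable]
        simp only [lintegral_indicator measurableSet_ball]
    _ ≤ 2 ^ (finrank ℝ X + 2) *
          ∫⁻ x in ⋃ k, ball (c k) (rad k), C₀ * maximalDensity μ E x ∂μ := by
        rw [← lintegral_indicator hU]
        refine mul_le_mul_right (lintegral_mono fun x => ?_) _
        by_cases hx : x ∈ ⋃ k, ball (c k) (rad k)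
        · rw [indicator_of_mem hx]
          refine le_trans (le_of_eq ?_) (mul_le_mul_left (hC x) _)
          rw [← ENNReal.tsum_mul_right]
          refine tsum_congr fun k => ?_
          by_cases hk : x ∈ ball (c k) (rad k) <;> simp [hk]
        · have : ∀ k, x ∉ ball (c k) (rad k) := fun k hk => hx (mem_iUnion_of_mem k hk)
          simp [indicator_of_notMem (this _)]
    _ = _ := by rw [lintegral_const_mul _ hmeas, mul_assoc]

end MaximalDensity

lemma lintegral_Ioo_rpow_lt_top {θ : ℝ} (hθ : 0 < θ) :
    ∫⁻ s in Ioo (0 : ℝ) 1, ENNReal.ofReal (s ^ (θ - 1)) < ⊤ :=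
  ((intervalIntegral.integrableOn_Ioo_rpow_iff one_pos).2 (by linarith)).lintegral_lt_top

/-- Dividing `t |E| ≤ K |E|^{1-θ}` by `|E|^{1-θ}`. -/
lemma ENNReal.mul_rpow_le_of_mul_le_mul_rpow_one_sub {t m K : ℝ≥0∞} {θ : ℝ} (hθ : 0 < θ)
    (hm : m ≠ ⊤) (h : t * m ≤ K * m ^ (1 - θ)) : t * m ^ θ ≤ K := by
  rcases eq_or_ne m 0 with rfl | hm0
  · simp [hθ]
  have h0 : m ^ (1 - θ) ≠ 0 := (ENNReal.rpow_pos (pos_iff_ne_zero.2 hm0) hm).ne'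
  have h1 : m ^ (1 - θ) ≠ ⊤ := by simp [ENNReal.rpow_eq_top_iff, hm0, hm]
  refine (ENNReal.mul_le_mul_iff_left h0 h1).1 ?_
  rw [mul_assoc, ← ENNReal.rpow_add _ _ hm0 hm]
  simpa using h

lemma ofReal_tsum_le {f : ℕ → ℝ} (hf : ∀ n, 0 ≤ f n) :
    ENNReal.ofReal (∑' n, f n) ≤ ∑' n, ENNReal.ofReal (f n) := by
  by_cases h : Summable f
  · rw [ENNReal.ofReal_tsum_of_nonneg hf h]
  · simp [tsum_eq_zero_of_not_summable h]

/-- Weak type bound for the Marcinkiewicz function of a family of balls with bounded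
overlap of the 10-fold dilates:
`‖Σ_k (1 + |x − c_k|/r_k)^{−(d+1)}‖_{L^{q₁,∞}} ≲ |⋃_k Q_k|^{1/q₁}`. -/
theorem stmt_7 (d : ℕ) (hd : 0 < d) (q₁ : ℝ≥0∞) (hq₁ : 1 ≤ q₁) (hq₁' : q₁ ≠ ⊤)
    (C₀ : ℝ≥0∞) (hC₀ : C₀ < ⊤) :
    ∃ B : ℝ≥0∞, B < ⊤ ∧
      ∀ (c : ℕ → EuclideanSpace ℝ (Fin d)) (rad : ℕ → ℝ),
        (∀ k, 0 < rad k) →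
        (∀ x : EuclideanSpace ℝ (Fin d),
          (∑' k, (Metric.ball (c k) (10 * rad k)).indicator (fun _ => (1 : ℝ≥0∞)) x) ≤ C₀) →
        wnorm (fun x : EuclideanSpace ℝ (Fin d) =>
            ∑' k, (1 + ‖x - c k‖ / rad k) ^ (-(d + 1) : ℝ)) q₁ ≤
          B * (volume (⋃ k, Metric.ball (c k) (rad k))) ^ (1 / q₁).toReal := by
  have : NeZero d := ⟨hd.ne'⟩
  have hq0 : q₁ ≠ 0 := (one_pos.trans_le hq₁).ne'
  rw [one_div]
  set θ := q₁⁻¹.toReal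
  have hθ : 0 < θ := ENNReal.toReal_pos (ENNReal.inv_ne_zero.2 hq₁') (ENNReal.inv_ne_top.2 hq0)
  have hθ' : θ ≤ 1 :=
    (ENNReal.toReal_mono ENNReal.one_ne_top (ENNReal.inv_le_one.2 hq₁)).trans_eq
      ENNReal.toReal_one
  set K : ℝ → ℝ≥0∞ := fun η => 2 ^ (d + 2) * C₀ *
    ((∫⁻ s in Ioo (0 : ℝ) 1, ENNReal.ofReal (s ^ (η - 1))) * (5 ^ d) ^ (1 - η)) with hK
  have hKtop : ∀ η, 0 < η → η ≤ 1 → K η < ⊤ := fun η h h' =>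
    ENNReal.mul_lt_top (ENNReal.mul_lt_top (by finiteness) hC₀)
      (ENNReal.mul_lt_top (lintegral_Ioo_rpow_lt_top h)
        (ENNReal.rpow_lt_top_of_nonneg (by linarith) (by finiteness)))
  refine ⟨K θ + 1, ENNReal.add_lt_top.2 ⟨hKtop θ hθ hθ', ENNReal.one_lt_top⟩,
    fun c rad hrad hC => ?_⟩
  set U := ⋃ k, Metric.ball (c k) (rad k)
  rcases eq_or_ne (volume U) ⊤ with hUtop | hUtop
  · rw [hUtop, ENNReal.top_rpow_of_pos hθ, ENNReal.mul_top (by simp)]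
    exact le_top
  have hC' : ∀ x, ∑' k, (ball (c k) (rad k)).indicator (fun _ => (1 : ℝ≥0∞)) x ≤ C₀ := fun x =>
    (ENNReal.tsum_le_tsum fun k => indicator_le_indicator_of_subset
      (ball_subset_ball (by linarith [hrad k])) (fun _ => zero_le) x).trans (hC x)
  set F : EuclideanSpace ℝ (Fin d) → ℝ≥0∞ := fun x =>
    ∑' k, ENNReal.ofReal ((1 + ‖x - c k‖ / rad k) ^ (-(d + 1) : ℝ))
  have hFmeas : Measurable F := Measurable.tsum fun k => by fun_prop
  refine iSup_le fun t => ?_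
  rcases eq_or_ne t 0 with rfl | ht
  · simp
  set E : Set (EuclideanSpace ℝ (Fin d)) := {x | (t : ℝ≥0∞) ≤ F x}
  have hsub : {x | (t : ℝ) < ‖∑' k, (1 + ‖x - c k‖ / rad k) ^ (-(d + 1) : ℝ)‖} ⊆ E := by
    intro x hx
    have hnn : ∀ k, 0 ≤ (1 + ‖x - c k‖ / rad k) ^ (-(d + 1) : ℝ) := fun k => by
      have := (hrad k).le
      positivity
    rw [mem_ofPred_eq, Real.norm_of_nonneg (tsum_nonneg hnn)] at hx
    refine le_trans ?_ (ofReal_tsum_le hnn)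
    rw [← ENNReal.ofReal_coe_nnreal]
    exact ENNReal.ofReal_le_ofReal hx.le
  have hmain : ∀ η, 0 < η → η ≤ 1 →
      t * volume E ≤ K η * volume U ^ η * volume E ^ (1 - η) := by
    intro η h h'
    calc t * volume E ≤ ∫⁻ y in E, F y := by
          rw [← setLIntegral_const]
          exact setLIntegral_mono hFmeas fun _ hx => hx
      _ ≤ 2 ^ (d + 2) * C₀ * ∫⁻ x in U, maximalDensity volume E x := by
          have := setLIntegral_tsum_bump_le volume (E := E) hrad hC'
          rwa [finrank_euclideanSpace, Fintype.card_fin] at this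
      _ ≤ _ := by
          have := setLIntegral_maximalDensity_le volume E U h h'
          rw [finrank_euclideanSpace, Fintype.card_fin,
            ENNReal.mul_rpow_of_nonneg _ _ (by linarith)] at this
          refine (mul_le_mul_right this _).trans (le_of_eq ?_)
          simp only [hK]
          ring
  have hEtop : volume E ≠ ⊤ := by
    intro htop
    have h := hmain 1 one_pos le_rfl
    rw [htop, ENNReal.mul_top (by simpa using ht), sub_self, ENNReal.rpow_zero, mul_one,
      ENNReal.rpow_one] at h
    exact (ENNReal.mul_lt_top (hKtop 1 one_pos le_rfl) hUtop.lt_top).ne (top_le_iff.1 h)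
  calc _ ≤ t * volume E ^ θ := by gcongr
    _ ≤ K θ * volume U ^ θ :=
        ENNReal.mul_rpow_le_of_mul_le_mul_rpow_one_sub hθ hEtop (hmain θ hθ hθ')
    _ ≤ _ := by gcongr; exact le_self_add
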